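/- arXiv:1512.05632 — 4 statements merged into one kernel-verified Lean document; each statement's English description precedes it below -/
import Mathlib

section
/- Let r > 1 and let k, ℓ, m be positive integers with k ≥ 2. The discrete-time Moran process with fitness r on the (k,ℓ,m)-metafunnel, started from a single initial mutant placed at a uniformly random vertex, has extinction probability at least 1/(2(m+r)). -/
open Finset

/-- Total fitness of the mutant set `S` (mutants have fitness `r`, non-mutants fitness `1`). -/
noncomputable def moranW {V : Type*} [Fintype V] (r : ℝ) (S : Finset V) : ℝ :=
  r * S.card + ((Fintype.card V : ℝ) - S.card)

/-- One-step transition probability of the Moran process with fitness `r` and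
reproduction weights `w`, from mutant set `S` to mutant set `T`:  a vertex `u` is chosen
with probability `r / moranW r S` if it is a mutant and `1 / moranW r S` otherwise, then a
target `v` is chosen with probability `w u v`, and `v` becomes a mutant if `u` is one and
a non-mutant otherwise. -/
noncomputable def moranStep {V : Type*} [Fintype V] [DecidableEq V]
    (r : ℝ) (w : V → V → ℝ) (S T : Finset V) : ℝ :=
  ∑ u : V, ∑ v : V,
    ((if u ∈ S then r else 1) / moranW r S) * w u v *
      (if (if u ∈ S then insert v S else S.erase v) = T then 1 else 0)

/-- Distribution of the Moran process after `t` steps, from initial distribution `init`. -/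
noncomputable def moranDist {V : Type*} [Fintype V] [DecidableEq V]
    (r : ℝ) (w : V → V → ℝ) (init : Finset V → ℝ) : ℕ → Finset V → ℝ
  | 0 => init
  | t + 1 => fun T => ∑ S : Finset V, moranDist r w init t S * moranStep r w S T

/-- Reproduction weights of the (unweighted) Moran process on the digraph with
out-neighbourhoods `out`: the offspring goes to a uniformly random out-neighbour. -/
noncomputable def outWeights {V : Type*} [DecidableEq V]
    (out : V → Finset V) : V → V → ℝ :=
  fun u v => if v ∈ out u then ((out u).card : ℝ)⁻¹ else 0

/-- Extinction probability: `sup_t Pr(S_t = ∅)`. -/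
noncomputable def extinctionProb {V : Type*} [Fintype V] [DecidableEq V]
    (r : ℝ) (w : V → V → ℝ) (init : Finset V → ℝ) : ℝ :=
  ⨆ t : ℕ, moranDist r w init t (∅ : Finset V)

/-- Fixation probability: `sup_t Pr(S_t = V)`. -/
noncomputable def fixationProb {V : Type*} [Fintype V] [DecidableEq V]
    (r : ℝ) (w : V → V → ℝ) (init : Finset V → ℝ) : ℝ :=
  ⨆ t : ℕ, moranDist r w init t (Finset.univ : Finset V)

/-- Initial distribution: a single mutant at a uniformly random vertex. -/
noncomputable def uniformSingleton (V : Type*) [Fintype V] [DecidableEq V] :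
    Finset V → ℝ :=
  fun S => if S.card = 1 then (Fintype.card V : ℝ)⁻¹ else 0

/-- Initial distribution: a single mutant at the fixed vertex `x₀`. -/
def pointInit {V : Type*} [DecidableEq V] (x₀ : V) : Finset V → ℝ :=
  fun S => if S = {x₀} then 1 else 0

/-- Vertices of the `(k,ℓ,m)`-metafunnel: the centre `v*` (`Sum.inl ()`) together with,
for each level index `i : Fin k` (representing level `i+1`) and each copy `j : Fin ℓ`,
a set `V_{i+1,j}` of `m ^ (i+1)` vertices.  It has `1 + ℓ·∑_{i=1}^k m^i` vertices. -/
abbrev MetafunnelV (k ℓ m : ℕ) : Type :=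
  Unit ⊕ (Σ i : Fin k, Fin ℓ × Fin (m ^ ((i : ℕ) + 1)))

/-- The level of a metafunnel vertex: the centre has level `0` and the vertices of
`V_{i,j}` have level `i`. -/
def mfLevel {k ℓ m : ℕ} : MetafunnelV k ℓ m → ℕ
  | Sum.inl _ => 0
  | Sum.inr ⟨i, _⟩ => (i : ℕ) + 1

/-- The copy of a metafunnel vertex: `some j` for a vertex of `V_{i,j}`, and `none` for
the centre. -/
def mfCopy {k ℓ m : ℕ} : MetafunnelV k ℓ m → Option (Fin ℓ)
  | Sum.inl _ => none
  | Sum.inr ⟨_, j, _⟩ => some j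

/-- Out-neighbourhoods of the `(k,ℓ,m)`-metafunnel: the centre points to all of `V_k`,
each vertex of `V_1` points to the centre, and each vertex of `V_{i+1,j}` points to all
of `V_{i,j}`. -/
def metafunnelOut (k ℓ m : ℕ) : MetafunnelV k ℓ m → Finset (MetafunnelV k ℓ m)
  | Sum.inl _ => Finset.univ.filter fun v => mfLevel v = k
  | Sum.inr ⟨i, j, _⟩ =>
      if (i : ℕ) = 0 then {Sum.inl ()}
      else Finset.univ.filter fun v => mfLevel v = (i : ℕ) ∧ mfCopy v = some j

section Generic

variable {V : Type*} [Fintype V] [DecidableEq V]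

theorem mf_W_pos [Nonempty V] (r : ℝ) (hr : 1 < r) (S : Finset V) : 0 < moranW r S := by
  have h1 : (S.card : ℝ) ≤ Fintype.card V := by exact_mod_cast Finset.card_le_univ S
  have h2 : (0 : ℝ) < Fintype.card V := by exact_mod_cast Fintype.card_pos
  have h3 : (0 : ℝ) ≤ S.card := by positivity
  unfold moranW
  nlinarith

theorem mf_step_nonneg [Nonempty V] (r : ℝ) (hr : 1 < r) (w : V → V → ℝ)
    (hw : ∀ u v, 0 ≤ w u v) (S T : Finset V) : 0 ≤ moranStep r w S T := by
  have hW := mf_W_pos r hr S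
  unfold moranStep
  refine Finset.sum_nonneg fun u _ => Finset.sum_nonneg fun v _ => ?_
  have h1 : (0 : ℝ) ≤ if u ∈ S then r else 1 := by split_ifs <;> linarith
  refine mul_nonneg (mul_nonneg (div_nonneg h1 hW.le) (hw u v)) ?_
  split_ifs <;> norm_num

theorem mf_sum_fit (r : ℝ) (S : Finset V) :
    ∑ u : V, (if u ∈ S then r else 1) = moranW r S := by
  have h : ∀ u : V, (if u ∈ S then r else 1) = (if u ∈ S then (r - 1) else 0) + 1 := by
    intro u; split_ifs <;> ring
  simp only [h, Finset.sum_add_distrib, Finset.sum_ite_mem, Finset.univ_inter]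
  simp [moranW]
  ring

theorem mf_step_sum [Nonempty V] (r : ℝ) (hr : 1 < r) (w : V → V → ℝ)
    (hs : ∀ u, ∑ v, w u v = 1) (S : Finset V) : ∑ T, moranStep r w S T = 1 := by
  have hW := mf_W_pos r hr S
  unfold moranStep
  rw [Finset.sum_comm]
  have : ∀ u : V, ∑ T : Finset V, ∑ v : V,
    ((if u ∈ S then r else 1) / moranW r S) * w u v *
      (if (if u ∈ S then insert v S else S.erase v) = T then (1 : ℝ) else 0)
      = (if u ∈ S then r else 1) / moranW r S := by
    intro u
    rw [Finset.sum_comm]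
    simp only [← Finset.mul_sum]
    simp only [Finset.sum_ite_eq, Finset.mem_univ, if_true, mul_one]
    rw [← Finset.mul_sum, hs, mul_one]
  rw [Finset.sum_congr rfl fun u _ => this u, ← Finset.sum_div, mf_sum_fit]
  exact div_self hW.ne'

theorem mf_dist_nonneg [Nonempty V] (r : ℝ) (hr : 1 < r) (w : V → V → ℝ)
    (hw : ∀ u v, 0 ≤ w u v) (init : Finset V → ℝ) (hi : ∀ S, 0 ≤ init S) (t : ℕ) :
    ∀ S, 0 ≤ moranDist r w init t S := by
  induction t with
  | zero => exact hi
  | succ t ih =>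
    intro S
    exact Finset.sum_nonneg fun T _ => mul_nonneg (ih T) (mf_step_nonneg r hr w hw T S)

theorem mf_dist_sum [Nonempty V] (r : ℝ) (hr : 1 < r) (w : V → V → ℝ)
    (hs : ∀ u, ∑ v, w u v = 1) (init : Finset V → ℝ) (t : ℕ) :
    ∑ S, moranDist r w init t S = ∑ S, init S := by
  induction t with
  | zero => rfl
  | succ t ih =>
    rw [← ih]
    simp only [moranDist]
    rw [Finset.sum_comm]
    refine Finset.sum_congr rfl fun S _ => ?_
    rw [← Finset.mul_sum, mf_step_sum r hr w hs, mul_one]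

theorem mf_step_empty [Nonempty V] (r : ℝ) (w : V → V → ℝ)
    (hs : ∀ u, ∑ v, w u v = 1) : moranStep r w (∅ : Finset V) ∅ = 1 := by
  have hn : (Fintype.card V : ℝ) ≠ 0 := by exact_mod_cast Fintype.card_ne_zero
  simp [moranStep, moranW, ← Finset.mul_sum, hs, hn]

theorem mf_W_single (r : ℝ) (u : V) :
    moranW r ({u} : Finset V) = r + (Fintype.card V - 1) := by
  simp [moranW]

theorem mf_step_kill (r : ℝ) (w : V → V → ℝ) (u : V) (h0 : w u u = 0) :
    moranStep r w ({u} : Finset V) ∅ = (∑ x, w x u) / moranW r ({u} : Finset V) := by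
  unfold moranStep
  rw [Finset.sum_div]
  refine Finset.sum_congr rfl fun x _ => ?_
  by_cases hx : x = u
  · subst hx
    simp [h0]
  · have : ∀ v : V, (({u} : Finset V).erase v = ∅) ↔ v = u := by
      intro v
      by_cases hv : v = u
      · subst hv; simp
      · simp [Finset.erase_eq_of_notMem, hv]
    simp only [Finset.mem_singleton, hx, if_false, this]
    simp
    ring

theorem mf_step_stay (r : ℝ) (w : V → V → ℝ)
    (hs : ∀ u, ∑ v, w u v = 1) (u : V) (h0 : w u u = 0) :
    moranStep r w ({u} : Finset V) {u} =
      ((Fintype.card V - 1 : ℝ) - ∑ x, w x u) / moranW r ({u} : Finset V) := by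
  unfold moranStep
  have key : ∀ x : V, (∑ v : V,
    ((if x ∈ ({u} : Finset V) then r else 1) / moranW r ({u} : Finset V)) * w x v *
      (if (if x ∈ ({u} : Finset V) then insert v ({u} : Finset V)
        else ({u} : Finset V).erase v) = {u} then (1 : ℝ) else 0))
      = ((1 - if x = u then 1 else 0) - w x u) / moranW r ({u} : Finset V) := by
    intro x
    by_cases hx : x = u
    · subst hx
      have : ∀ v : V, (insert v ({x} : Finset V) = {x}) ↔ v = x := by
        intro v; simp
      simp only [Finset.mem_singleton, if_true, this]
      simp [h0]
    · have : ∀ v : V, (({u} : Finset V).erase v = {u}) ↔ ¬ v = u := by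
        intro v; simp
      simp only [Finset.mem_singleton, hx, if_false, this]
      have h2 : ∀ v : V, 1 / moranW r ({u} : Finset V) * w x v * (if ¬ v = u then (1 : ℝ) else 0)
          = 1 / moranW r ({u} : Finset V) * (w x v - if v = u then w x v else 0) := by
        intro v; split_ifs <;> simp
      simp only [h2]
      rw [← Finset.mul_sum, Finset.sum_sub_distrib, hs]
      simp
      ring
  rw [Finset.sum_congr rfl fun x _ => key x, ← Finset.sum_div]
  simp [Finset.sum_sub_distrib]

theorem mf_extinction_generic [Nonempty V] (r : ℝ) (hr : 1 < r) (w : V → V → ℝ)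
    (hw : ∀ u v, 0 ≤ w u v) (hs : ∀ u, ∑ v, w u v = 1) (h0 : ∀ u, w u u = 0)
    (U : Finset V) :
    (Fintype.card V : ℝ)⁻¹ * ∑ u ∈ U, (∑ x, w x u) / ((∑ x, w x u) + r) ≤
      extinctionProb r w (uniformSingleton V) := by
  set n : ℝ := (Fintype.card V : ℝ) with hn
  have hnpos : 0 < n := by rw [hn]; exact_mod_cast Fintype.card_pos
  set κ : V → ℝ := fun u => ∑ x, w x u with hκ
  have hκ0 : ∀ u, 0 ≤ κ u := fun u => Finset.sum_nonneg fun x _ => hw x u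
  set s : V → ℝ := fun u => moranStep r w ({u} : Finset V) {u} with hsdef
  have hs0 : ∀ u, 0 ≤ s u := fun u => mf_step_nonneg r hr w hw _ _
  have hi : ∀ S, 0 ≤ uniformSingleton V S := by
    intro S; unfold uniformSingleton; split_ifs <;> positivity
  have hW : ∀ u : V, 0 < moranW r ({u} : Finset V) := fun u => mf_W_pos r hr _
  have hsv : ∀ u, s u = 1 - (κ u + r) / moranW r ({u} : Finset V) := by
    intro u
    have := hW u
    simp only [hsdef]
    rw [mf_step_stay r w hs u (h0 u)]
    rw [eq_sub_iff_add_eq, ← add_div, div_eq_one_iff_eq this.ne', mf_W_single]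
    simp only [hκ]; ring
  have hs1 : ∀ u, s u < 1 := by
    intro u
    rw [hsv]
    have : 0 < (κ u + r) / moranW r ({u} : Finset V) :=
      div_pos (by linarith [hκ0 u]) (hW u)
    linarith
  have hdn := mf_dist_nonneg r hr w hw (uniformSingleton V) hi
  have ha : ∀ t u, n⁻¹ * s u ^ t ≤ moranDist r w (uniformSingleton V) t {u} := by
    intro t u
    induction t with
    | zero => simp [moranDist, uniformSingleton, hn]
    | succ t ih =>
      calc n⁻¹ * s u ^ (t+1) = (n⁻¹ * s u ^ t) * s u := by ring
        _ ≤ moranDist r w (uniformSingleton V) t {u} * s u :=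
            mul_le_mul_of_nonneg_right ih (hs0 u)
        _ ≤ _ := by
            simp only [moranDist]
            exact Finset.single_le_sum
              (f := fun S => moranDist r w (uniformSingleton V) t S * moranStep r w S {u})
              (fun S _ => mul_nonneg (hdn t S) (mf_step_nonneg r hr w hw S _))
              (Finset.mem_univ ({u} : Finset V))
  have hb : ∀ t, n⁻¹ * ∑ u ∈ U, κ u / (κ u + r) * (1 - s u ^ t) ≤
      moranDist r w (uniformSingleton V) t ∅ := by
    intro t
    induction t with
    | zero => simpa using hdn 0 ∅
    | succ t ih =>
      have e : ∀ u, κ u / (κ u + r) * (1 - s u ^ (t+1)) =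
          κ u / (κ u + r) * (1 - s u ^ t) + s u ^ t * (κ u / moranW r ({u} : Finset V)) := by
        intro u
        have h1 := hW u
        have h2 : κ u + r ≠ 0 := by linarith [hκ0 u]
        rw [pow_succ]
        nth_rewrite 2 [hsv u]
        field_simp
        ring
      simp only [e]
      rw [Finset.sum_add_distrib, mul_add]
      have hsplit : moranDist r w (uniformSingleton V) t ∅ * moranStep r w ∅ ∅ +
          ∑ u ∈ U, moranDist r w (uniformSingleton V) t {u} * moranStep r w {u} ∅ ≤
          moranDist r w (uniformSingleton V) (t+1) ∅ := by
        simp only [moranDist]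
        set f : Finset V → ℝ :=
          fun S => moranDist r w (uniformSingleton V) t S * moranStep r w S ∅ with hf
        have hf0 : ∀ S, 0 ≤ f S :=
          fun S => mul_nonneg (hdn t S) (mf_step_nonneg r hr w hw S _)
        have hinj : ∑ u ∈ U, f {u} = ∑ S ∈ U.image (fun u => ({u} : Finset V)), f S := by
          rw [Finset.sum_image]
          intro a _ b _ hab
          exact Finset.singleton_injective hab
        change f ∅ + ∑ u ∈ U, f {u} ≤ ∑ S, f S
        have hnot : (∅ : Finset V) ∉ U.image (fun u => ({u} : Finset V)) := by simp
        rw [hinj, ← Finset.sum_insert hnot]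
        exact Finset.sum_le_sum_of_subset_of_nonneg (Finset.subset_univ _)
          (fun S _ _ => hf0 S)
      refine le_trans (add_le_add ?_ ?_) hsplit
      · rw [mf_step_empty r w hs, mul_one]; exact ih
      · rw [Finset.mul_sum]
        refine Finset.sum_le_sum fun u _ => ?_
        rw [mf_step_kill r w u (h0 u), ← mul_assoc]
        exact mul_le_mul_of_nonneg_right (ha t u) (div_nonneg (hκ0 u) (hW u).le)
  have hbdd : BddAbove (Set.range fun t => moranDist r w (uniformSingleton V) t ∅) := by
    refine ⟨∑ S, uniformSingleton V S, ?_⟩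
    rintro _ ⟨t, rfl⟩
    change moranDist r w (uniformSingleton V) t ∅ ≤ _
    rw [← mf_dist_sum r hr w hs (uniformSingleton V) t]
    exact Finset.single_le_sum (fun S _ => hdn t S) (Finset.mem_univ _)
  have hlim : Filter.Tendsto (fun t : ℕ => n⁻¹ * ∑ u ∈ U, κ u / (κ u + r) * (1 - s u ^ t))
      Filter.atTop (nhds (n⁻¹ * ∑ u ∈ U, κ u / (κ u + r) * (1 - 0))) := by
    refine Filter.Tendsto.const_mul _ (tendsto_finsetSum _ fun u _ => ?_)
    exact Filter.Tendsto.const_mul _ (Filter.Tendsto.const_sub _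
      (tendsto_pow_atTop_nhds_zero_of_lt_one (hs0 u) (hs1 u)))
  simp only [sub_zero, mul_one] at hlim
  exact le_of_tendsto' hlim fun t => (hb t).trans (le_ciSup hbdd t)

end Generic

section Funnel

theorem mf_level_inl {k ℓ m : ℕ} (x : Unit) :
    mfLevel (Sum.inl x : MetafunnelV k ℓ m) = 0 := rfl

theorem mf_level_inr {k ℓ m : ℕ} (i : Fin k) (p : Fin ℓ × Fin (m ^ ((i : ℕ) + 1))) :
    mfLevel (Sum.inr ⟨i, p⟩ : MetafunnelV k ℓ m) = (i : ℕ) + 1 := rfl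

theorem mf_copy_inr {k ℓ m : ℕ} (i : Fin k) (p : Fin ℓ × Fin (m ^ ((i : ℕ) + 1))) :
    mfCopy (Sum.inr ⟨i, p⟩ : MetafunnelV k ℓ m) = some p.1 := rfl

theorem mf_out_nonempty (k ℓ m : ℕ) (hℓ : 0 < ℓ) (hm : 0 < m) (hk : 0 < k)
    (u : MetafunnelV k ℓ m) : (metafunnelOut k ℓ m u).Nonempty := by
  rcases u with _ | ⟨i, j, a⟩
  · refine ⟨Sum.inr ⟨⟨k - 1, by omega⟩, ⟨0, hℓ⟩, ⟨0, by positivity⟩⟩, ?_⟩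
    simp [metafunnelOut, mf_level_inl, mf_level_inr]
    omega
  · by_cases hi : (i : ℕ) = 0
    · simp [metafunnelOut, hi]
    · refine ⟨Sum.inr ⟨⟨i - 1, by omega⟩, j, ⟨0, by positivity⟩⟩, ?_⟩
      simp [metafunnelOut, mf_level_inl, mf_level_inr, mf_copy_inr, hi]
      omega

theorem mf_not_self (k ℓ m : ℕ) (hk : 0 < k) (u : MetafunnelV k ℓ m) :
    u ∉ metafunnelOut k ℓ m u := by
  rcases u with _ | ⟨i, j, a⟩
  · simp [metafunnelOut, mf_level_inl, mf_level_inr]; omega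
  · by_cases hi : (i : ℕ) = 0
    · simp [metafunnelOut, hi]
    · simp [metafunnelOut, mf_level_inl, mf_level_inr, hi]

theorem mf_weights_nonneg {V : Type*} [DecidableEq V] (out : V → Finset V) (u v : V) :
    0 ≤ outWeights out u v := by
  unfold outWeights; split_ifs <;> positivity

theorem mf_weights_sum {V : Type*} [Fintype V] [DecidableEq V] (out : V → Finset V) (u : V)
    (h : (out u).Nonempty) : ∑ v, outWeights out u v = 1 := by
  have : ((out u).card : ℝ) ≠ 0 := by exact_mod_cast h.card_pos.ne'
  simp [outWeights, this]

theorem mf_layer_card (k ℓ m : ℕ) (i : Fin k) (j : Fin ℓ) :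
    ((Finset.univ : Finset (MetafunnelV k ℓ m)).filter
      fun v => mfLevel v = (i : ℕ) + 1 ∧ mfCopy v = some j).card ≤ m ^ ((i : ℕ) + 1) := by
  have hsub : ((Finset.univ : Finset (MetafunnelV k ℓ m)).filter
      fun v => mfLevel v = (i : ℕ) + 1 ∧ mfCopy v = some j) ⊆
      (Finset.univ : Finset (Fin (m ^ ((i : ℕ) + 1)))).image
        (fun a => (Sum.inr ⟨i, j, a⟩ : MetafunnelV k ℓ m)) := by
    intro v hv
    rcases v with _ | ⟨i', j', a⟩
    · simp [mf_level_inl, mf_level_inr] at hv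
    · simp [mf_level_inl, mf_level_inr, mf_copy_inr] at hv
      obtain ⟨h1, rfl⟩ := hv
      obtain rfl : i' = i := Fin.ext h1
      simp
  refine (Finset.card_le_card hsub).trans (Finset.card_image_le.trans ?_)
  simp

theorem mf_kill_rate (k ℓ m : ℕ) (hk : 0 < k) (hℓ : 0 < ℓ) (hm : 0 < m)
    (u : MetafunnelV k ℓ m) (hu : mfLevel u ≠ k) :
    (m : ℝ) ≤ ∑ x, outWeights (metafunnelOut k ℓ m) x u := by
  have hm' : (0 : ℝ) < m := by exact_mod_cast hm
  rcases u with _ | ⟨i, j, a⟩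
  · set g : Fin (m ^ (0 + 1)) → MetafunnelV k ℓ m :=
      fun b => Sum.inr ⟨⟨0, hk⟩, ⟨0, hℓ⟩, b⟩ with hg
    have hinj : Function.Injective g := by
      intro b c h; simpa [hg] using h
    calc (m : ℝ) = ∑ b, outWeights (metafunnelOut k ℓ m) (g b) (Sum.inl ()) := by
          simp [hg, outWeights, metafunnelOut]
      _ = ∑ x ∈ Finset.univ.map ⟨g, hinj⟩,
            outWeights (metafunnelOut k ℓ m) x (Sum.inl ()) := by
          rw [Finset.sum_map]; rfl
      _ ≤ _ := Finset.sum_le_sum_of_subset_of_nonneg (Finset.subset_univ _)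
          (fun _ _ _ => mf_weights_nonneg _ _ _)
  · have hik : (i : ℕ) + 1 < k := by
      simp [mf_level_inl, mf_level_inr] at hu
      omega
    set g : Fin (m ^ ((i : ℕ) + 1 + 1)) → MetafunnelV k ℓ m :=
      fun b => Sum.inr ⟨⟨i + 1, hik⟩, j, b⟩ with hg
    have hinj : Function.Injective g := by
      intro b c h; simpa [hg] using h
    have hterm : ∀ b, ((m : ℝ) ^ ((i : ℕ) + 1))⁻¹ ≤
        outWeights (metafunnelOut k ℓ m) (g b) (Sum.inr ⟨i, j, a⟩) := by
      intro b
      have ho : metafunnelOut k ℓ m (g b) = Finset.univ.filter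
        fun v => mfLevel v = (i : ℕ) + 1 ∧ mfCopy v = some j := by
        simp [hg, metafunnelOut]
      have hmem : (Sum.inr ⟨i, j, a⟩ : MetafunnelV k ℓ m) ∈ metafunnelOut k ℓ m (g b) := by
        rw [ho]; simp [mf_level_inl, mf_level_inr, mf_copy_inr]
      unfold outWeights
      rw [if_pos hmem]
      have h1 : (0 : ℝ) < (metafunnelOut k ℓ m (g b)).card := by
        exact_mod_cast Finset.card_pos.mpr ⟨_, hmem⟩
      have h2 : ((metafunnelOut k ℓ m (g b)).card : ℝ) ≤ (m : ℝ) ^ ((i : ℕ) + 1) := by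
        rw [ho]; exact_mod_cast mf_layer_card k ℓ m i j
      exact inv_anti₀ h1 h2
    calc (m : ℝ) = ∑ b : Fin (m ^ ((i : ℕ) + 1 + 1)), ((m : ℝ) ^ ((i : ℕ) + 1))⁻¹ := by
          simp
          field_simp
          ring
      _ ≤ ∑ b, outWeights (metafunnelOut k ℓ m) (g b) (Sum.inr ⟨i, j, a⟩) :=
          Finset.sum_le_sum fun b _ => hterm b
      _ = ∑ x ∈ Finset.univ.map ⟨g, hinj⟩,
            outWeights (metafunnelOut k ℓ m) x (Sum.inr ⟨i, j, a⟩) := by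
          rw [Finset.sum_map]; rfl
      _ ≤ _ := Finset.sum_le_sum_of_subset_of_nonneg (Finset.subset_univ _)
          (fun _ _ _ => mf_weights_nonneg _ _ _)

theorem mf_card (k ℓ m : ℕ) (hk : 2 ≤ k) :
    Fintype.card (MetafunnelV k ℓ m) ≤
      (m + 1) * ((Finset.univ : Finset (MetafunnelV k ℓ m)).filter
        fun v => mfLevel v ≠ k).card := by
  obtain ⟨k, rfl⟩ : ∃ k', k = k' + 2 := ⟨k - 2, by omega⟩
  have hA : ((Finset.univ : Finset (MetafunnelV (k + 2) ℓ m)).filter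
        fun v => mfLevel v = k + 2).card ≤ ℓ * m ^ (k + 2) := by
    have hsub : ((Finset.univ : Finset (MetafunnelV (k + 2) ℓ m)).filter
        fun v => mfLevel v = k + 2) ⊆
        (Finset.univ : Finset (Fin ℓ × Fin (m ^ (k + 1 + 1)))).image
          (fun p => (Sum.inr ⟨⟨k + 1, by omega⟩, p⟩ : MetafunnelV (k + 2) ℓ m)) := by
      intro v hv
      rcases v with _ | ⟨⟨i, hi⟩, p⟩
      · simp [mf_level_inl, mf_level_inr] at hv
      · simp [mf_level_inl, mf_level_inr] at hv
        obtain rfl : i = k + 1 := by omega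
        simp only [Finset.mem_image, Finset.mem_univ, true_and]
        exact ⟨p, rfl⟩
    refine (Finset.card_le_card hsub).trans (Finset.card_image_le.trans ?_)
    simp
  have hB : ℓ * m ^ (k + 1) ≤ ((Finset.univ : Finset (MetafunnelV (k + 2) ℓ m)).filter
        fun v => mfLevel v ≠ k + 2).card := by
    set g : Fin ℓ × Fin (m ^ (k + 1)) → MetafunnelV (k + 2) ℓ m :=
      fun p => Sum.inr ⟨⟨k, by omega⟩, p⟩ with hg
    have hinj : Function.Injective g := by
      intro b c h; simpa [hg] using h
    calc ℓ * m ^ (k + 1) = (Finset.univ.map ⟨g, hinj⟩).card := by simp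
      _ ≤ _ := by
        refine Finset.card_le_card ?_
        intro v hv
        simp only [Finset.mem_map, Finset.mem_univ, true_and] at hv
        obtain ⟨p, rfl⟩ := hv
        simp [hg, mf_level_inl, mf_level_inr]
  have hC := Finset.card_filter_add_card_filter_not
    (s := (Finset.univ : Finset (MetafunnelV (k + 2) ℓ m))) (fun v => mfLevel v = k + 2)
  rw [Finset.card_univ] at hC
  rw [← hC]
  have := Nat.mul_le_mul_left m hB
  have e : ℓ * m ^ (k + 2) = m * (ℓ * m ^ (k + 1)) := by ring
  simp only [ne_eq] at *
  linarith

end Funnel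

/-- **Easy extinction lower bound for metafunnels** (Lemma 5.2).  Let `r > 1` and let
`k`, `ℓ`, `m` be positive integers with `k ≥ 2`.  The discrete-time Moran process with
fitness `r` on the `(k,ℓ,m)`-metafunnel, started from a single initial mutant at a
uniformly random vertex, has extinction probability at least `1/(2(m+r))`. -/
theorem metafunnel_extinction_simple (r : ℝ) (hr : 1 < r) (k ℓ m : ℕ)
    (hk : 2 ≤ k) (hℓ : 0 < ℓ) (hm : 0 < m) :
    1 / (2 * ((m : ℝ) + r)) ≤
      extinctionProb r (outWeights (metafunnelOut k ℓ m))
        (uniformSingleton (MetafunnelV k ℓ m)) := by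
  classical
  have : Nonempty (MetafunnelV k ℓ m) := ⟨Sum.inl ()⟩
  have hk0 : 0 < k := by omega
  have hm1 : (1 : ℝ) ≤ m := by exact_mod_cast hm
  refine le_trans ?_ (mf_extinction_generic r hr (outWeights (metafunnelOut k ℓ m))
    (mf_weights_nonneg _)
    (fun u => mf_weights_sum _ u (mf_out_nonempty k ℓ m hℓ hm hk0 u))
    (fun u => by simp [outWeights, mf_not_self k ℓ m hk0 u])
    ((Finset.univ : Finset (MetafunnelV k ℓ m)).filter fun v => mfLevel v ≠ k))
  set U := (Finset.univ : Finset (MetafunnelV k ℓ m)).filter fun v => mfLevel v ≠ k with hU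
  have h1 : (U.card : ℝ) * ((m : ℝ) / (m + r)) ≤
      ∑ u ∈ U, (∑ x, outWeights (metafunnelOut k ℓ m) x u) /
        ((∑ x, outWeights (metafunnelOut k ℓ m) x u) + r) := by
    rw [← nsmul_eq_mul]
    refine Finset.card_nsmul_le_sum _ _ _ fun u hu => ?_
    have hκ := mf_kill_rate k ℓ m hk0 hℓ hm u (by simpa [hU] using hu)
    rw [div_le_div_iff₀ (by linarith) (by linarith)]
    nlinarith
  have h2 : (Fintype.card (MetafunnelV k ℓ m) : ℝ) ≤ (m + 1) * U.card := by
    exact_mod_cast mf_card k ℓ m hk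
  have h3 : (0 : ℝ) < Fintype.card (MetafunnelV k ℓ m) := by exact_mod_cast Fintype.card_pos
  have h4 : (0 : ℝ) ≤ U.card := by positivity
  refine le_trans ?_ (mul_le_mul_of_nonneg_left h1 (inv_nonneg.mpr h3.le))
  have h5 : (Fintype.card (MetafunnelV k ℓ m) : ℝ) ≤ 2 * (U.card * m) := by nlinarith
  have h6 : (0 : ℝ) < m + r := by linarith
  generalize (Fintype.card (MetafunnelV k ℓ m) : ℝ) = n at *
  have e : n⁻¹ * ((U.card : ℝ) * ((m : ℝ) / (m + r))) = (U.card * m) / (n * (m + r)) := by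
    field_simp
  rw [e, div_le_div_iff₀ (by positivity) (by positivity)]
  nlinarith
end

section
/- Let r > 1 and let k, ℓ, m be positive integers with m ≥ 12r. For every fixed initial mutant x_0 lying in one of the reservoirs R_1∪…∪R_ℓ, the discrete-time Moran process with fitness r on the (k,ℓ,m)-megastar started from the state {x_0} has extinction probability at least 1/(26·r²·ℓ). -/
open Finset

/-- Vertices of the `(k,ℓ,m)`-megastar: `ℓ` reservoirs `R_i` of size `m`
(`Sum.inl (i, x)`), `ℓ` feeder vertices `a_i` (`Sum.inr (Sum.inl i)`), `ℓ` cliques `K_i`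
of size `k` (`Sum.inr (Sum.inr (Sum.inl (i, x)))`), and the centre vertex `v*`
(`Sum.inr (Sum.inr (Sum.inr ()))`).  It has `1 + ℓ * (m + 1 + k)` vertices. -/
abbrev MegastarV (k ℓ m : ℕ) : Type :=
  (Fin ℓ × Fin m) ⊕ (Fin ℓ ⊕ ((Fin ℓ × Fin k) ⊕ Unit))

/-- Out-neighbourhoods of the `(k,ℓ,m)`-megastar: the centre points to every reservoir
vertex, each vertex of `R_i` points to `a_i`, each `a_i` points to every vertex of `K_i`,
the vertices within each clique `K_i` are pairwise connected in both directions, and every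
clique vertex points to the centre. -/
def megastarOut (k ℓ m : ℕ) : MegastarV k ℓ m → Finset (MegastarV k ℓ m)
  | Sum.inl (i, _) => {Sum.inr (Sum.inl i)}
  | Sum.inr (Sum.inl i) =>
      (Finset.univ : Finset (Fin k)).image fun x => Sum.inr (Sum.inr (Sum.inl (i, x)))
  | Sum.inr (Sum.inr (Sum.inl (i, x))) =>
      (((Finset.univ : Finset (Fin k)).erase x).image
          fun y => Sum.inr (Sum.inr (Sum.inl (i, y)))) ∪
        {Sum.inr (Sum.inr (Sum.inr ()))}
  | Sum.inr (Sum.inr (Sum.inr _)) =>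
      (Finset.univ : Finset (Fin ℓ × Fin m)).image fun p => Sum.inl p


/-- The next state when `u` reproduces onto `v`. -/
def moranNext {V : Type*} [DecidableEq V] (S : Finset V) (u v : V) : Finset V :=
  if u ∈ S then insert v S else S.erase v

/-- The selection rate of the vertex `u`. -/
noncomputable def moranRate {V : Type*} [DecidableEq V] (r : ℝ) (S : Finset V) (u : V) : ℝ :=
  if u ∈ S then r else 1

lemma moranRate_pos {V : Type*} [DecidableEq V] {r : ℝ} (hr : 1 < r) (S : Finset V) (u : V) :
    0 < moranRate r S u := by
  unfold moranRate; split_ifs <;> linarith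

lemma moranW_pos {V : Type*} [Fintype V] [Nonempty V] {r : ℝ} (hr : 1 < r) (S : Finset V) :
    0 < moranW r S := by
  unfold moranW
  have h1 : (0 : ℝ) < Fintype.card V := by exact_mod_cast Fintype.card_pos
  have h2 : (0 : ℝ) ≤ S.card := by positivity
  nlinarith

lemma sum_moranRate {V : Type*} [Fintype V] [DecidableEq V] (r : ℝ) (S : Finset V) :
    ∑ u, moranRate r S u = moranW r S := by
  have : ∀ u, moranRate r S u = 1 + (if u ∈ S then (r - 1) else 0) := by
    intro u; unfold moranRate; split_ifs <;> ring
  simp only [this, Finset.sum_add_distrib, Finset.sum_ite_mem, Finset.univ_inter]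
  simp [moranW]
  ring

lemma step_expect {V : Type*} [Fintype V] [DecidableEq V] (r : ℝ) (w : V → V → ℝ)
    (S : Finset V) (f : Finset V → ℝ) :
    ∑ T, moranStep r w S T * f T =
      (∑ u, moranRate r S u * ∑ v, w u v * f (moranNext S u v)) / moranW r S := by
  unfold moranStep
  simp only [Finset.sum_mul]
  rw [Finset.sum_comm, Finset.sum_div]
  refine Finset.sum_congr rfl fun u _ => ?_
  rw [Finset.sum_comm, Finset.mul_sum, Finset.sum_div]
  refine Finset.sum_congr rfl fun v _ => ?_
  rw [Finset.sum_eq_single (moranNext S u v)]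
  · simp only [moranNext, moranRate, if_true, mul_one]
    split_ifs <;> ring
  · intro T _ hT
    have : ¬ ((if u ∈ S then insert v S else S.erase v) = T) := fun h => hT h.symm
    simp [this]
  · simp

lemma step_nonneg {V : Type*} [Fintype V] [DecidableEq V] [Nonempty V] {r : ℝ} (hr : 1 < r)
    {w : V → V → ℝ} (hw : ∀ u v, 0 ≤ w u v) (S T : Finset V) : 0 ≤ moranStep r w S T := by
  unfold moranStep
  refine Finset.sum_nonneg fun u _ => Finset.sum_nonneg fun v _ => ?_
  refine mul_nonneg (mul_nonneg (div_nonneg (moranRate_pos hr S u).le (moranW_pos hr S).le)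
    (hw u v)) ?_
  split_ifs <;> norm_num

lemma step_pos {V : Type*} [Fintype V] [DecidableEq V] [Nonempty V] {r : ℝ} (hr : 1 < r)
    {w : V → V → ℝ} (hw : ∀ u v, 0 ≤ w u v) (S T : Finset V) (u v : V) (huv : 0 < w u v)
    (hT : moranNext S u v = T) : 0 < moranStep r w S T := by
  have hnn : ∀ u v, 0 ≤ ((if u ∈ S then r else 1) / moranW r S) * w u v *
      (if (if u ∈ S then insert v S else S.erase v) = T then (1 : ℝ) else 0) := by
    intro u v
    refine mul_nonneg (mul_nonneg (div_nonneg (moranRate_pos hr S u).le (moranW_pos hr S).le)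
      (hw u v)) ?_
    split_ifs <;> norm_num
  unfold moranStep
  refine Finset.sum_pos' (fun u _ => Finset.sum_nonneg fun v _ => hnn u v)
    ⟨u, Finset.mem_univ _, Finset.sum_pos' (fun v _ => hnn u v) ⟨v, Finset.mem_univ _, ?_⟩⟩
  have : (if u ∈ S then insert v S else S.erase v) = T := hT
  rw [if_pos this, mul_one]
  exact mul_pos (div_pos (moranRate_pos hr S u) (moranW_pos hr S)) huv

lemma step_sum {V : Type*} [Fintype V] [DecidableEq V] [Nonempty V] {r : ℝ} (hr : 1 < r)
    {w : V → V → ℝ} (hw1 : ∀ u, ∑ v, w u v = 1) (S : Finset V) :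
    ∑ T, moranStep r w S T = 1 := by
  have h := step_expect r w S (fun _ => 1)
  simp only [mul_one, hw1, sum_moranRate] at h
  rw [h, div_self (moranW_pos hr S).ne']

lemma step_empty {V : Type*} [Fintype V] [DecidableEq V] [Nonempty V] {r : ℝ} (hr : 1 < r)
    {w : V → V → ℝ} (hw1 : ∀ u, ∑ v, w u v = 1) :
    moranStep r w ∅ ∅ = 1 := by
  have h := step_expect r w ∅ (fun T => if T = ∅ then 1 else 0)
  simp only [mul_ite, mul_one, mul_zero, Finset.sum_ite_eq', Finset.mem_univ, if_true] at h
  rw [h]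
  simp only [moranNext, Finset.notMem_empty, if_false, Finset.erase_empty, if_true, hw1, mul_one,
    sum_moranRate]
  exact div_self (moranW_pos hr _).ne'

/-- A subharmonic function that vanishes outside `∅, A, B` bounds the extinction probability. -/
lemma extinction_of_subharmonic {V : Type*} [Fintype V] [DecidableEq V] [Nonempty V] {r : ℝ}
    (hr : 1 < r) {w : V → V → ℝ} (hw : ∀ u v, 0 ≤ w u v) (hw1 : ∀ u, ∑ v, w u v = 1)
    (x₀ : V) (B : Finset V) (hB : B ≠ ∅) (hAB : B ≠ {x₀})
    (pA pB : ℝ) (f : Finset V → ℝ)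
    (hf : ∀ T, f T = if T = ∅ then 1 else if T = {x₀} then pA else if T = B then pB else 0)
    (hsub : ∀ S, f S ≤ ∑ T, moranStep r w S T * f T)
    (hA0 : 0 < moranStep r w {x₀} ∅) (hBA : 0 < moranStep r w B {x₀}) :
    pA ≤ extinctionProb r w (pointInit x₀) := by
  set d := moranDist r w (pointInit x₀) with hd
  have hA : ({x₀} : Finset V) ≠ ∅ := Finset.singleton_ne_empty _
  have hsucc : ∀ t T, d (t + 1) T = ∑ S, d t S * moranStep r w S T := fun t T => rfl
  have hst := step_nonneg hr hw
  have hnn : ∀ t T, 0 ≤ d t T := by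
    intro t
    induction t with
    | zero => intro T; change 0 ≤ pointInit x₀ T; unfold pointInit; split_ifs <;> norm_num
    | succ t ih =>
      intro T; rw [hsucc]
      exact Finset.sum_nonneg fun S _ => mul_nonneg (ih S) (hst S T)
  have hexp : ∀ (g : Finset V → ℝ) t, ∑ T, d (t + 1) T * g T =
      ∑ S, d t S * ∑ T, moranStep r w S T * g T := by
    intro g t
    simp only [hsucc, Finset.sum_mul, Finset.mul_sum]
    rw [Finset.sum_comm]
    exact Finset.sum_congr rfl fun _ _ => Finset.sum_congr rfl fun _ _ => by ring
  have hinit : ∀ g : Finset V → ℝ, ∑ T, d 0 T * g T = g {x₀} := by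
    intro g
    change ∑ T, pointInit x₀ T * g T = g {x₀}
    simp [pointInit]
  have hsum : ∀ t, ∑ T, d t T = 1 := by
    intro t
    induction t with
    | zero => simpa using hinit (fun _ => 1)
    | succ t ih =>
      have := hexp (fun _ => 1) t
      simp only [mul_one, step_sum hr hw1] at this
      rw [this, ih]
  have hle1 : ∀ t T, d t T ≤ 1 := fun t T => by
    rw [← hsum t]; exact Finset.single_le_sum (fun S _ => hnn t S) (Finset.mem_univ T)
  have hbdd : BddAbove (Set.range fun t => d t ∅) := ⟨1, by rintro _ ⟨t, rfl⟩; exact hle1 t ∅⟩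
  have he : ∀ t, d t ∅ + d t {x₀} * moranStep r w {x₀} ∅ ≤ d (t + 1) ∅ := by
    intro t
    rw [hsucc]
    have h2 := Finset.sum_le_sum_of_subset_of_nonneg
      (f := fun S => d t S * moranStep r w S ∅)
      (Finset.subset_univ ({∅, {x₀}} : Finset (Finset V)))
      (fun S _ _ => mul_nonneg (hnn t S) (hst S ∅))
    rw [Finset.sum_pair hA.symm, step_empty hr hw1, mul_one] at h2
    exact h2
  have hmono : Monotone fun t => d t ∅ :=
    monotone_nat_of_le_succ fun t => by
      have := he t
      have := mul_nonneg (hnn t {x₀}) hA0.le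
      linarith
  have hlim := tendsto_atTop_ciSup hmono hbdd
  have hlim' := (Filter.tendsto_add_atTop_iff_nat 1).2 hlim
  have ha : Filter.Tendsto (fun t => d t {x₀}) Filter.atTop (nhds 0) := by
    have h := (hlim'.sub hlim).div_const (moranStep r w {x₀} ∅)
    rw [sub_self, zero_div] at h
    refine squeeze_zero (fun t => hnn t _) (fun t => ?_) h
    rw [le_div_iff₀ hA0]
    have := he t
    linarith
  have hb : Filter.Tendsto (fun t => d t B) Filter.atTop (nhds 0) := by
    have h := ((Filter.tendsto_add_atTop_iff_nat 1).2 ha).div_const (moranStep r w B {x₀})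
    rw [zero_div] at h
    refine squeeze_zero (fun t => hnn t _) (fun t => ?_) h
    rw [le_div_iff₀ hBA, hsucc]
    exact Finset.single_le_sum (f := fun S => d t S * moranStep r w S {x₀})
      (fun S _ => mul_nonneg (hnn t S) (hst S _)) (Finset.mem_univ B)
  have hE : ∀ t, pA ≤ ∑ T, d t T * f T := by
    intro t
    induction t with
    | zero => rw [hinit, hf, if_neg hA, if_pos rfl]
    | succ t ih =>
      rw [hexp]
      exact ih.trans (Finset.sum_le_sum fun S _ => mul_le_mul_of_nonneg_left (hsub S) (hnn t S))
  have hE' : ∀ t, ∑ T, d t T * f T = d t ∅ + d t {x₀} * pA + d t B * pB := by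
    intro t
    have : ∀ T, d t T * f T = (if T = ∅ then d t T else 0) +
        (if T = {x₀} then d t T * pA else 0) + (if T = B then d t T * pB else 0) := by
      intro T
      rw [hf]
      by_cases h0 : T = ∅
      · subst h0; simp [hA.symm, hB.symm]
      · by_cases h1 : T = {x₀}
        · subst h1; simp [hAB.symm]
        · by_cases h2 : T = B <;> simp [h0, h1, h2, hB, hAB]
    simp only [this, Finset.sum_add_distrib, Finset.sum_ite_eq', Finset.mem_univ, if_true]
  have hfin : Filter.Tendsto (fun t => d t ∅ + d t {x₀} * pA + d t B * pB) Filter.atTop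
      (nhds ((⨆ t, d t ∅) + 0 * pA + 0 * pB)) :=
    (hlim.add (ha.mul_const pA)).add (hb.mul_const pB)
  have := ge_of_tendsto' hfin (fun t => (hE' t) ▸ hE t)
  simpa [extinctionProb] using this

lemma outWeights_sum {V : Type*} [Fintype V] [DecidableEq V] (out : V → Finset V) (u : V)
    (g : V → ℝ) :
    ∑ v, outWeights out u v * g v = ((out u).card : ℝ)⁻¹ * ∑ v ∈ out u, g v := by
  simp only [outWeights, ite_mul, zero_mul, Finset.sum_ite_mem, Finset.univ_inter, Finset.mul_sum]

lemma megastarOut_nonempty {k ℓ m : ℕ} (hk : 0 < k) (hℓ : 0 < ℓ) (hm : 0 < m)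
    (u : MegastarV k ℓ m) : (megastarOut k ℓ m u).Nonempty := by
  rcases u with ⟨i, x⟩ | i | ⟨i, x⟩ | u
  · exact ⟨_, Finset.mem_singleton_self _⟩
  · exact ⟨_, Finset.mem_image_of_mem _ (Finset.mem_univ ⟨0, hk⟩)⟩
  · exact ⟨_, Finset.mem_union_right _ (Finset.mem_singleton_self _)⟩
  · exact ⟨_, Finset.mem_image_of_mem _ (Finset.mem_univ (⟨0, hℓ⟩, ⟨0, hm⟩))⟩

/-- If every out-neighbour gives value at least `c`, so does the average. -/
lemma avg_ge {V : Type*} [Fintype V] [DecidableEq V] (out : V → Finset V) (u : V)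
    (hne : (out u).Nonempty) (g : V → ℝ) (c : ℝ) (h : ∀ v ∈ out u, c ≤ g v) :
    c ≤ ∑ v, outWeights out u v * g v := by
  rw [outWeights_sum]
  have hc : (0 : ℝ) < (out u).card := by exact_mod_cast hne.card_pos
  have := Finset.card_nsmul_le_sum _ _ _ h
  rw [nsmul_eq_mul] at this
  rw [inv_mul_eq_div, le_div_iff₀ hc]
  linarith

lemma avg_center {k ℓ m : ℕ} (hℓ : 0 < ℓ) (hm : 0 < m) (g : MegastarV k ℓ m → ℝ)
    (p₀ : Fin ℓ × Fin m) (c D : ℝ) (h0 : c + D ≤ g (Sum.inl p₀))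
    (h : ∀ p, p ≠ p₀ → c ≤ g (Sum.inl p)) :
    c + 1 / (ℓ * m : ℝ) * D ≤
      ∑ v, outWeights (megastarOut k ℓ m) (Sum.inr (Sum.inr (Sum.inr ()))) v * g v := by
  rw [outWeights_sum]
  have hinj : Function.Injective (fun p : Fin ℓ × Fin m => (Sum.inl p : MegastarV k ℓ m)) :=
    Sum.inl_injective
  have hc : (megastarOut k ℓ m (Sum.inr (Sum.inr (Sum.inr ())))).card = ℓ * m := by
    simp only [megastarOut]
    rw [Finset.card_image_of_injective _ hinj]; simp
  rw [hc]
  simp only [megastarOut]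
  rw [Finset.sum_image (fun _ _ _ _ h => hinj h)]
  have h1 : ∑ p : Fin ℓ × Fin m, (c + if p = p₀ then D else 0) ≤
      ∑ p : Fin ℓ × Fin m, g (Sum.inl p) := by
    refine Finset.sum_le_sum fun p _ => ?_
    by_cases hp : p = p₀
    · subst hp; simpa using h0
    · simpa [hp] using h p hp
  simp only [Finset.sum_add_distrib, Finset.sum_ite_eq', Finset.mem_univ, if_true] at h1
  simp at h1
  have hpos : (0 : ℝ) < ℓ * m := by positivity
  push_cast
  rw [inv_mul_eq_div, le_div_iff₀ hpos]
  field_simp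
  linarith

/-- **Extinction lower bound for megastars from a reservoir** (Lemma 7.2).  Let `r > 1`
and let `k`, `ℓ`, `m` be positive integers with `m ≥ 12r`.  For every fixed initial
mutant `x₀` lying in a reservoir, the discrete-time Moran process with fitness `r` on
the `(k,ℓ,m)`-megastar started from `{x₀}` has extinction probability at least
`1/(26·r²·ℓ)`. -/
theorem megastar_extinction_reservoir (r : ℝ) (hr : 1 < r) (k ℓ m : ℕ)
    (hk : 0 < k) (hℓ : 0 < ℓ) (hm0 : 0 < m) (hm : 12 * r ≤ (m : ℝ))
    (x₀ : MegastarV k ℓ m) (hx₀ : ∃ i x, x₀ = Sum.inl (i, x)) :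
    1 / (26 * r ^ 2 * (ℓ : ℝ)) ≤
      extinctionProb r (outWeights (megastarOut k ℓ m)) (pointInit x₀) := by
  obtain ⟨i, x, rfl⟩ := hx₀
  have hℓ' : (1 : ℝ) ≤ ℓ := by exact_mod_cast hℓ
  have hm12 : (12 : ℝ) < m := by linarith
  have hm2 : 12 < m := by exact_mod_cast hm12
  set w := outWeights (megastarOut k ℓ m) with hwdef
  have hne := megastarOut_nonempty (k := k) hk hℓ hm0
  have hw : ∀ u v, 0 ≤ w u v := by
    intro u v; rw [hwdef]; unfold outWeights; split_ifs <;> positivity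
  have hw1 : ∀ u, ∑ v, w u v = 1 := by
    intro u
    have h := outWeights_sum (megastarOut k ℓ m) u (fun _ => 1)
    simp only [mul_one] at h
    rw [hwdef, h]
    have : ((megastarOut k ℓ m u).card : ℝ) ≠ 0 := by exact_mod_cast (hne u).card_pos.ne'
    simp [this]
  have hwpos : ∀ u v, v ∈ megastarOut k ℓ m u → 0 < w u v := by
    intro u v huv
    rw [hwdef]; unfold outWeights; rw [if_pos huv]
    have : (0 : ℝ) < (megastarOut k ℓ m u).card := by exact_mod_cast (hne u).card_pos
    positivity
  have : Nonempty (MegastarV k ℓ m) := ⟨Sum.inl (i, x)⟩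
  set x₀ : MegastarV k ℓ m := Sum.inl (i, x) with hx₀
  set a : MegastarV k ℓ m := Sum.inr (Sum.inl i) with ha
  set B : Finset (MegastarV k ℓ m) := {x₀, a} with hBdef
  have hxa : x₀ ≠ a := by simp [hx₀, ha]
  have hB : B ≠ ∅ := Finset.insert_ne_empty _ _
  have hAB : B ≠ {x₀} := by
    intro h
    have : a ∈ ({x₀} : Finset _) := h ▸ (by simp [hBdef])
    exact hxa (Finset.mem_singleton.1 this).symm
  have hA : ({x₀} : Finset (MegastarV k ℓ m)) ≠ ∅ := Finset.singleton_ne_empty _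
  set p : ℝ := 1 / (26 * r ^ 2 * (ℓ : ℝ)) with hp
  set q : ℝ := p * (1 - 2 * r / (m - 1)) with hq
  set ε : ℝ := 1 / (ℓ * m : ℝ) with hε
  have hr2 : 1 < r ^ 2 := by nlinarith
  have hp0 : 0 < p := by rw [hp]; positivity
  have hpl : p * (26 * r ^ 2 * ℓ) = 1 := by rw [hp]; field_simp
  have hp1 : p ≤ 1 / 26 := by nlinarith [mul_le_mul hr2.le hℓ' (by norm_num) (by positivity)]
  have hm1 : (0 : ℝ) < m - 1 := by linarith
  have hs : 2 * r / (m - 1) ≤ 1 := by rw [div_le_one hm1]; linarith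
  have hs0 : 0 < 2 * r / ((m : ℝ) - 1) := by positivity
  have hq0 : 0 ≤ q := mul_nonneg hp0.le (by linarith)
  have hqp : q ≤ p := by rw [hq]; nlinarith
  have hε0 : 0 < ε := by rw [hε]; positivity
  have hε1 : ε ≤ 1 := by
    rw [hε, div_le_one (by positivity)]; nlinarith
  have hmq : (m - 1 : ℝ) * (p - q) = 2 * r * p := by rw [hq]; field_simp; ring
  have ineqB : 0 ≤ (m - 1 : ℝ) * (p - q) - r * q - ε * q := by
    rw [hmq]; nlinarith
  have ineqA : 0 ≤ r * (q - p) + ε * (1 - p) := by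
    have h1 : r * (p - q) ≤ ε * (1 / 2) := by
      have h2 : r * (p - q) = 2 * r ^ 2 * p / (m - 1) := by rw [hq]; field_simp; ring
      rw [h2, hε, div_le_iff₀ hm1]
      have h3 : r ^ 2 * p = 1 / (26 * ℓ) := by rw [hp]; field_simp
      have h4 : 2 * r ^ 2 * p = 1 / (13 * ℓ) := by rw [mul_assoc, h3]; field_simp; norm_num
      rw [h4]
      have hm0' : (0 : ℝ) < m := by linarith
      have hl0 : (0 : ℝ) < ℓ := by linarith
      have h5 : 1 / (ℓ * m : ℝ) * (1 / 2) * (m - 1) = 1 / (13 * ℓ) * (13 * (m - 1) / (2 * m)) := by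
        field_simp
      rw [h5]
      refine le_mul_of_one_le_right (by positivity) ?_
      rw [le_div_iff₀ (by positivity)]; linarith
    nlinarith
  set f : Finset (MegastarV k ℓ m) → ℝ := fun T =>
    if T = ∅ then 1 else if T = {x₀} then p else if T = B then q else 0 with hf
  have f0 : f ∅ = 1 := by simp [hf]
  have fA : f {x₀} = p := by simp [hf]
  have fB : f B = q := by simp only [hf]; rw [if_neg hB, if_neg hAB, if_pos trivial]
  have fnn : ∀ T, 0 ≤ f T := by
    intro T; simp only [hf]; split_ifs <;> first | linarith | norm_num
  have hnot : ∀ (S : Finset (MegastarV k ℓ m)) u v, u ∉ S → v ∉ S → moranNext S u v = S := by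
    intro S u v hu hv
    unfold moranNext; rw [if_neg hu, Finset.erase_eq_of_notMem hv]
  have hin : ∀ (S : Finset (MegastarV k ℓ m)) u v, u ∈ S → v ∈ S → moranNext S u v = S := by
    intro S u v hu hv
    unfold moranNext; rw [if_pos hu, Finset.insert_eq_of_mem hv]
  refine extinction_of_subharmonic hr hw hw1 x₀ B hB hAB p q f (fun T => rfl) ?_ ?_ ?_
  · intro S
    rw [step_expect]
    have hW := moranW_pos hr S
    rw [le_div_iff₀ hW]
    by_cases hS0 : S = ∅
    · subst hS0
      simp only [moranNext, Finset.notMem_empty, if_false, Finset.erase_empty, f0, mul_one, hw1,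
        sum_moranRate, one_mul, le_refl]
    by_cases hSA : S = {x₀}
    · subst hSA
      rw [fA, ← sum_moranRate]
      have key : ∀ u, moranRate r {x₀} u * p +
          (if u = x₀ then r * (q - p) else 0) +
          (if u = Sum.inr (Sum.inr (Sum.inr ())) then ε * (1 - p) else 0) ≤
          moranRate r {x₀} u * ∑ v, w u v * f (moranNext {x₀} u v) := by
        intro u
        by_cases hu : u = x₀
        · subst hu
          have h1 : moranRate r {x₀} x₀ = r := by simp [moranRate]
          have h2 : q ≤ ∑ v, w x₀ v * f (moranNext {x₀} x₀ v) := by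
            refine avg_ge _ _ (hne _) _ _ fun v hv => ?_
            have hv' : v = a := by simpa [hx₀, megastarOut] using hv
            subst hv'
            have : moranNext {x₀} x₀ a = B := by
              unfold moranNext; rw [if_pos (Finset.mem_singleton_self _), hBdef, Finset.pair_comm]
            rw [this, fB]
          rw [h1, if_pos rfl, if_neg (by simp [hx₀])]
          nlinarith
        · have hu' : u ∉ ({x₀} : Finset _) := by simpa using hu
          have h1 : moranRate r {x₀} u = 1 := by simp [moranRate, hu]
          rw [h1, if_neg hu, one_mul, one_mul, add_zero]
          by_cases huc : u = Sum.inr (Sum.inr (Sum.inr ()))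
          · subst huc
            rw [if_pos rfl]
            refine avg_center hℓ hm0 _ (i, x) _ _ ?_ ?_
            · have : moranNext {x₀} (Sum.inr (Sum.inr (Sum.inr ()))) x₀ = ∅ := by
                unfold moranNext; rw [if_neg hu']; simp
              rw [← hx₀, this, f0]; linarith
            · intro y hy
              rw [hnot _ _ _ hu' (by simpa [hx₀] using hy), fA]
          · rw [if_neg huc, add_zero]
            refine avg_ge _ _ (hne _) _ _ fun v hv => ?_
            have hv' : v ∉ ({x₀} : Finset _) := by
              rw [Finset.mem_singleton]; rintro rfl
              rcases u with ⟨j, y⟩ | j | ⟨j, y⟩ | u <;> simp [megastarOut, hx₀] at hv huc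
            rw [hnot _ _ _ hu' hv', fA]
      have := Finset.sum_le_sum (s := Finset.univ) fun u _ => key u
      simp only [Finset.sum_add_distrib, Finset.sum_ite_eq', Finset.mem_univ, if_true] at this
      rw [← Finset.sum_mul] at this
      linarith
    by_cases hSB : S = B
    · subst hSB
      rw [fB, ← sum_moranRate]
      have hxB : x₀ ∈ B := by simp [hBdef]
      have haB : a ∈ B := by simp [hBdef]
      have key : ∀ u, moranRate r B u * q +
          (if u ∈ (Finset.univ.erase x).image (fun y => (Sum.inl (i, y) : MegastarV k ℓ m))
            then p - q else 0) +
          (if u = a then - (r * q) else 0) +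
          (if u = Sum.inr (Sum.inr (Sum.inr ())) then ε * (- q) else 0) ≤
          moranRate r B u * ∑ v, w u v * f (moranNext B u v) := by
        intro u
        by_cases hux : u = x₀
        · subst hux
          rw [if_neg (by simp [hx₀]), if_neg hxa, if_neg (by simp [hx₀])]
          simp only [add_zero]
          refine mul_le_mul_of_nonneg_left ?_ (moranRate_pos hr _ _).le
          refine avg_ge _ _ (hne _) _ _ fun v hv => ?_
          have hv' : v = a := by simpa [hx₀, megastarOut] using hv
          subst hv'
          rw [hin _ _ _ hxB haB, fB]
        by_cases hua : u = a
        · subst hua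
          rw [if_neg (by simp [ha]), if_pos rfl, if_neg (by simp [ha])]
          have h1 : moranRate r B a = r := by simp [moranRate, haB]
          have h2 : 0 ≤ ∑ v, w a v * f (moranNext B a v) :=
            Finset.sum_nonneg fun v _ => mul_nonneg (hw _ _) (fnn _)
          rw [h1]
          nlinarith
        have huB : u ∉ B := by simp [hBdef, hux, hua]
        have h1 : moranRate r B u = 1 := by simp [moranRate, huB]
        rw [h1, if_neg hua, one_mul, one_mul, add_zero]
        by_cases huc : u = Sum.inr (Sum.inr (Sum.inr ()))
        · subst huc
          rw [if_pos rfl, if_neg (by simp), add_zero]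
          refine avg_center hℓ hm0 _ (i, x) _ _ ?_ ?_
          · rw [add_neg_cancel]; exact fnn _
          · intro y hy
            rw [hnot _ _ _ huB (by simpa [hBdef, hx₀, ha] using hy), fB]
        rw [if_neg huc, add_zero]
        by_cases hur : u ∈ (Finset.univ.erase x).image (fun y => (Sum.inl (i, y) : MegastarV k ℓ m))
        · rw [if_pos hur]
          obtain ⟨y, hy, rfl⟩ := Finset.mem_image.1 hur
          refine avg_ge _ _ (hne _) _ _ fun v hv => ?_
          have hv' : v = a := by simpa [megastarOut] using hv
          subst hv'
          have : moranNext B (Sum.inl (i, y)) a = {x₀} := by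
            unfold moranNext; rw [if_neg huB, hBdef]
            ext z; simp only [Finset.mem_erase, Finset.mem_insert, Finset.mem_singleton]
            constructor
            · rintro ⟨h, h' | h'⟩
              · exact h'
              · exact absurd h' h
            · rintro rfl; exact ⟨hxa, Or.inl rfl⟩
          rw [this, fA]; linarith
        · rw [if_neg hur, add_zero]
          refine avg_ge _ _ (hne _) _ _ fun v hv => ?_
          have hv' : v ∉ B := by
            intro hvB
            rw [hBdef, Finset.mem_insert, Finset.mem_singleton] at hvB
            rcases hvB with rfl | rfl
            · rcases u with ⟨j, y⟩ | j | ⟨j, y⟩ | u <;> simp [megastarOut, hx₀] at hv huc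
            · rcases u with ⟨j, y⟩ | j | ⟨j, y⟩ | u
              · simp [megastarOut, ha] at hv
                subst hv
                apply hur
                simp [hx₀] at hux ⊢
                exact hux
              · simp [megastarOut, ha] at hv
              · simp [megastarOut, ha] at hv
              · simp [megastarOut, ha] at hv
          rw [hnot _ _ _ huB hv', fB]
      have := Finset.sum_le_sum (s := Finset.univ) fun u _ => key u
      simp only [Finset.sum_add_distrib, Finset.sum_ite_eq', Finset.mem_univ, if_true,
        Finset.sum_ite_mem, Finset.univ_inter, Finset.sum_const] at this
      rw [← Finset.sum_mul, Finset.card_image_of_injective _ (by intro y z h; simpa using h),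
        Finset.card_erase_of_mem (Finset.mem_univ _), Finset.card_univ, Fintype.card_fin,
        nsmul_eq_mul, Nat.cast_sub hm0, Nat.cast_one] at this
      linarith
    · have : f S = 0 := by simp only [hf]; rw [if_neg hS0, if_neg hSA, if_neg hSB]
      rw [this, zero_mul]
      exact Finset.sum_nonneg fun u _ => mul_nonneg (moranRate_pos hr _ _).le
        (Finset.sum_nonneg fun v _ => mul_nonneg (hw _ _) (fnn _))
  · refine step_pos hr hw _ _ (Sum.inr (Sum.inr (Sum.inr ()))) x₀ (hwpos _ _ ?_) ?_
    · simp [megastarOut, hx₀]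
    · unfold moranNext; rw [if_neg (by simp [hx₀])]; simp
  · obtain ⟨y, hy⟩ : ∃ y : Fin m, y ≠ x := by
      have : Nontrivial (Fin m) := Fin.nontrivial_iff_two_le.2 (by omega)
      exact exists_ne x
    refine step_pos hr hw _ _ (Sum.inl (i, y)) a (hwpos _ _ ?_) ?_
    · simp [megastarOut, ha]
    · unfold moranNext
      rw [if_neg (by simp [hBdef, hx₀, ha, hy]), hBdef]
      ext z; simp only [Finset.mem_erase, Finset.mem_insert, Finset.mem_singleton]
      constructor
      · rintro ⟨h, h' | h'⟩
        · exact h'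
        · exact absurd h' h
      · rintro rfl; exact ⟨hxa, Or.inl rfl⟩
end

section
/- Let a, b, c, d be integers with a < b < c−1 and c+1 < d, and let p₁ ∈ (1/2, 1). Let f: {b, b+1, …, d} → ℝ satisfy f(b) = 0, f(d) = 1, f(i) = p₁·f(i+1) + (1−p₁)·f(i−1) for all integers i with b < i ≤ c, and f(i) = (1/3)·f(i+1) + (2/3)·f(i−1) for all integers i with c < i < d (so that f(i) is the probability that the Markov chain of the context, started at state i, visits state d without passing through state b). Then f(c) ≥ 1 − ((1−p₁)/p₁)^{c−b}·2^{d−c}. -/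
/-- **Back-to-back gambler's ruin, success probability** (Lemma 2.8(i)).  Let `a`, `b`,
`c`, `d` be integers with `a < b < c - 1` and `c + 1 < d`, and let `p₁ ∈ (1/2, 1)`.
Suppose `f : ℤ → ℝ` satisfies `f b = 0`, `f d = 1`,
`f i = p₁·f (i+1) + (1-p₁)·f (i-1)` for `b < i ≤ c`, and
`f i = (1/3)·f (i+1) + (2/3)·f (i-1)` for `c < i < d` — so that `f i` is the probability
that the associated birth-and-death chain, started at state `i`, visits state `d`
without passing through state `b`.  Then
`f c ≥ 1 - ((1-p₁)/p₁)^{c-b} · 2^{d-c}`. -/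
theorem back_to_back_gamblers_ruin_success (a b c d : ℤ)
    (hab : a < b) (hbc : b < c - 1) (hcd : c + 1 < d)
    (p₁ : ℝ) (hp : 1 / 2 < p₁) (hp1 : p₁ < 1)
    (f : ℤ → ℝ) (hfb : f b = 0) (hfd : f d = 1)
    (hrec1 : ∀ i : ℤ, b < i → i ≤ c → f i = p₁ * f (i + 1) + (1 - p₁) * f (i - 1))
    (hrec2 : ∀ i : ℤ, c < i → i < d →
      f i = (1 / 3) * f (i + 1) + (2 / 3) * f (i - 1)) :
    1 - ((1 - p₁) / p₁) ^ (c - b) * (2 : ℝ) ^ (d - c) ≤ f c := by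
  have hp0 : 0 < p₁ := by linarith
  obtain ⟨m, hm⟩ : ∃ m : ℕ, c = b + (m : ℤ) := ⟨(c - b).toNat, by omega⟩
  obtain ⟨n, hn⟩ : ∃ n : ℕ, d = c + (n : ℤ) := ⟨(d - c).toNat, by omega⟩
  have e1 : c - b = (m : ℤ) := by omega
  have e2 : d - c = (n : ℤ) := by omega
  rw [e1, e2, zpow_natCast, zpow_natCast]
  obtain ⟨r, hr⟩ : ∃ r : ℝ, r = (1 - p₁) / p₁ := ⟨_, rfl⟩
  rw [← hr]
  have hr0 : 0 ≤ r := by rw [hr]; exact div_nonneg (by linarith) hp0.le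
  have hrp : r * p₁ = 1 - p₁ := by rw [hr]; field_simp
  obtain ⟨x, hx⟩ : ∃ x : ℝ, x = f (b + 1) := ⟨_, rfl⟩
  have h1 : ∀ k : ℕ, k ≤ m → f (b + k) = x * ∑ i ∈ Finset.range k, r ^ i ∧
      f (b + k + 1) = x * ∑ i ∈ Finset.range (k + 1), r ^ i := by
    intro k
    induction k with
    | zero => intro _; simp [hfb, hx]
    | succ k ih =>
      intro hk
      obtain ⟨ha, hb⟩ := ih (by omega)
      have h := hrec1 (b + k + 1) (by omega) (by omega)
      rw [show b + (k : ℤ) + 1 - 1 = b + k by ring] at h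
      push_cast
      rw [← add_assoc]
      refine ⟨hb, ?_⟩
      rw [Finset.sum_range_succ] at hb
      rw [Finset.sum_range_succ, Finset.sum_range_succ]
      apply mul_left_cancel₀ hp0.ne'
      rw [hb, ha] at h
      rw [pow_succ]
      linear_combination -h - x * r ^ k * hrp
  obtain ⟨hc, hc1⟩ := h1 m le_rfl
  rw [← hm] at hc hc1
  rw [Finset.sum_range_succ, mul_add, ← hc] at hc1
  have h2 : ∀ j : ℕ, j + 1 ≤ n → f (c + j) = f c + x * r ^ m * (2 ^ j - 1) ∧
      f (c + j + 1) = f c + x * r ^ m * (2 ^ (j + 1) - 1) := by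
    intro j
    induction j with
    | zero => intro _; simp [hc1]; ring
    | succ j ih =>
      intro hj
      obtain ⟨ha, hb⟩ := ih (by omega)
      have h := hrec2 (c + j + 1) (by omega) (by omega)
      rw [show c + (j : ℤ) + 1 - 1 = c + j by ring] at h
      push_cast
      rw [← add_assoc]
      refine ⟨hb, ?_⟩
      rw [hb, ha] at h
      rw [pow_succ] at h ⊢
      rw [pow_succ]
      linear_combination -3 * h
  have hd := (h2 (n - 1) (by omega)).2
  rw [show n - 1 + 1 = n by omega, show c + ((n - 1 : ℕ) : ℤ) + 1 = d by omega, hfd] at hd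
  have hS : 1 ≤ ∑ i ∈ Finset.range m, r ^ i := by
    have := Finset.single_le_sum (f := fun i => r ^ i) (s := Finset.range m)
      (fun i _ => pow_nonneg hr0 i) (Finset.mem_range.2 (show 0 < m by omega))
    simpa using this
  have hR : 0 ≤ r ^ m := pow_nonneg hr0 m
  have hT : (1 : ℝ) ≤ 2 ^ n := one_le_pow₀ (by norm_num)
  generalize (∑ i ∈ Finset.range m, r ^ i) = S at *
  generalize r ^ m = R at *
  generalize (2 : ℝ) ^ n = T at *
  have hRT : 0 ≤ R * (T - 1) := mul_nonneg hR (by linarith)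
  have hx1 : x ≤ 1 := by
    by_contra hcon
    push Not at hcon
    have hA : x * 1 ≤ x * S := mul_le_mul_of_nonneg_left hS (by linarith)
    have hB : 0 ≤ x * (R * (T - 1)) := mul_nonneg (by linarith) hRT
    nlinarith
  have := mul_le_mul_of_nonneg_right hx1 hRT
  nlinarith
end

section
/- Let a, b, c, d be integers with a < b < c−1 and c+1 < d, and let p₁ ∈ (1/2, 1). Let h: {a, a+1, …, d} → ℝ satisfy h(a) = 0, h(d) = 0, h(i) = 1 + p₁·h(i+1) + (1−p₁)·h(i−1) for all integers i with a < i ≤ c, and h(i) = 1 + (1/3)·h(i+1) + (2/3)·h(i−1) for all integers i with c < i < d (so that h(i) is the expected number of transitions until the Markov chain of the context, started at state i, hits a state in {a,d}). Then h(c) ≤ 2^{d−c+1}·(3p₁−1)/(2p₁−1). -/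
/-- **Back-to-back gambler's ruin, expected absorption time** (Lemma 2.8(ii)).  Let
`a`, `b`, `c`, `d` be integers with `a < b < c - 1` and `c + 1 < d`, and let
`p₁ ∈ (1/2, 1)`.  Suppose `h : ℤ → ℝ` satisfies `h a = 0`, `h d = 0`,
`h i = 1 + p₁·h (i+1) + (1-p₁)·h (i-1)` for `a < i ≤ c`, and
`h i = 1 + (1/3)·h (i+1) + (2/3)·h (i-1)` for `c < i < d` — so that `h i` is the
expected number of transitions until the associated birth-and-death chain, started at
state `i`, hits a state in `{a, d}`.  Then
`h c ≤ 2^{d-c+1} · (3p₁-1)/(2p₁-1)`. -/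
theorem back_to_back_gamblers_ruin_time (a b c d : ℤ)
    (hab : a < b) (hbc : b < c - 1) (hcd : c + 1 < d)
    (p₁ : ℝ) (hp : 1 / 2 < p₁) (hp1 : p₁ < 1)
    (h : ℤ → ℝ) (hha : h a = 0) (hhd : h d = 0)
    (hrec1 : ∀ i : ℤ, a < i → i ≤ c → h i = 1 + p₁ * h (i + 1) + (1 - p₁) * h (i - 1))
    (hrec2 : ∀ i : ℤ, c < i → i < d →
      h i = 1 + (1 / 3) * h (i + 1) + (2 / 3) * h (i - 1)) :
    h c ≤ (2 : ℝ) ^ (d - c + 1) * ((3 * p₁ - 1) / (2 * p₁ - 1)) := by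
  have hq : 0 < 2 * p₁ - 1 := by linarith
  obtain ⟨n, hn⟩ := Int.eq_ofNat_of_zero_le (show 0 ≤ d - c by omega)
  obtain ⟨m, hm⟩ := Int.eq_ofNat_of_zero_le (show 0 ≤ c - a by omega)
  have e : (2 : ℝ) ^ (d - c + 1) = 2 * 2 ^ n := by
    rw [hn, zpow_add₀ (by norm_num), zpow_natCast]
    ring
  rw [e]
  have hq0 : 2 * p₁ - 1 ≠ 0 := hq.ne'
  have hpos : 0 < (2 : ℝ) ^ n := by positivity
  have h1n : (1 : ℝ) ≤ 2 ^ n := one_le_pow₀ (by norm_num)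
  have hSe : 1 / (2 * p₁ - 1) * (2 * p₁ - 1) = 1 := div_mul_cancel₀ 1 hq0
  have hR : (3 * p₁ - 1) / (2 * p₁ - 1) = (3 + 1 / (2 * p₁ - 1)) / 2 := by
    rw [div_eq_iff hq0]
    linear_combination (-1 / 2) * hSe
  have hS : 0 < 1 / (2 * p₁ - 1) := by positivity
  rw [hR]
  generalize 1 / (2 * p₁ - 1) = S at *
  have up : ∀ k : ℕ, c + k < d →
      h (c + k) = h c + 3 * k + (2 ^ k - 1) * (h (c + 1) - h c - 3) ∧
      h (c + k + 1) = h c + 3 * (k + 1) + (2 ^ (k + 1) - 1) * (h (c + 1) - h c - 3) := by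
    intro k
    induction k with
    | zero => 
      intro _
      constructor
      · simp
      · simp
        ring
    | succ k ih =>
      intro hk
      push_cast at hk ⊢
      obtain ⟨h1, h2⟩ := ih (by omega)
      have h3 := hrec2 (c + k + 1) (by omega) (by omega)
      rw [show c + (k : ℤ) + 1 - 1 = c + k by ring] at h3
      rw [show c + ((k : ℤ) + 1) = c + k + 1 by ring]
      refine ⟨h2, ?_⟩
      have h4 : h (c + k + 1 + 1) = 3 * h (c + k + 1) - 3 - 2 * h (c + k) := by linarith
      rw [h4, h1, h2]
      ring
  by_cases hD : h (c + 1) - h c < -S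
  · have down : ∀ k : ℕ, a ≤ c - k →
        h (c - k + 1) - h (c - k) < -S ∧ h c ≤ h (c - k) := by
      intro k
      induction k with
      | zero => 
        intro _
        simpa using hD
      | succ k ih =>
        intro hk
        push_cast at hk ⊢
        obtain ⟨h1, h2⟩ := ih (by omega)
        have h3 := hrec1 (c - k) (by omega) (by omega)
        rw [show c - ((k : ℤ) + 1) + 1 = c - k by ring,
          show c - ((k : ℤ) + 1) = c - k - 1 by ring]
        have h5 : h (c - k) - h (c - k - 1) < -S := by
          have : (1 - p₁) * (h (c - k) - h (c - k - 1)) < (1 - p₁) * (-S) := by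
            nlinarith
          exact lt_of_mul_lt_mul_left this (by linarith)
        exact ⟨h5, by linarith⟩
    have h6 := (down m (by omega)).2
    rw [show c - (m : ℤ) = a by omega, hha] at h6
    have : 0 ≤ 2 * 2 ^ n * ((3 + S) / 2) := by positivity
    linarith
  · obtain ⟨k, rfl⟩ : ∃ k, n = k + 1 := ⟨n - 1, by omega⟩
    have h6 := (up k (by push_cast at hn; omega)).2
    rw [show c + (k : ℤ) + 1 = d by push_cast at hn; omega, hhd] at h6
    have hk : (0 : ℝ) ≤ k := by positivity
    nlinarith [mul_nonneg (sub_nonneg.2 h1n) (sub_nonneg.2 (not_lt.1 hD))]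
end
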